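/- For all 0 < α ≤ 1/2 and 0 < β ≤ 1/2, the sequence a_n := Γ_S^(n)(⌊α·2^n⌋, 2⌊βn/2⌋) satisfies: Γ_IID(α,β) ≤ liminf_{n→∞} a_n, (1/2)·Γ_IID(2α,β) ≤ liminf_{n→∞} a_n, and limsup_{n→∞} a_n ≤ 2·Γ_IID(α,β). -/

import Mathlib

open Finset

noncomputable section

/-- The Hamming ball of radius `r` around the all-ones vector in `{-1,1}^n`
(vertices modeled as `Fin n → ℤˣ`, where `ℤˣ = {1, -1}`). -/
def hBall (n r : ℕ) : Finset (Fin n → ℤˣ) :=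
  Finset.univ.filter fun z => hammingDist z 1 ≤ r

/-- The Hamming sphere of radius `r` around the all-ones vector. -/
def hSphere (n r : ℕ) : Finset (Fin n → ℤˣ) :=
  Finset.univ.filter fun z => hammingDist z 1 = r

/-- Ball-noise stability `E[f(X) f(X∘Z)]`, `X` uniform on the cube, `Z` uniform on `B_r`. -/
def BStab (n r : ℕ) (f : (Fin n → ℤˣ) → ℝ) : ℝ :=
  (∑ x : Fin n → ℤˣ, ∑ z ∈ hBall n r, f x * f (x * z)) / (2 ^ n * (hBall n r).card)

/-- Sphere-noise stability `E[f(X) f(X∘Z)]`, `X` uniform on the cube, `Z` uniform on `S_r`. -/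
def SStab (n r : ℕ) (f : (Fin n → ℤˣ) → ℝ) : ℝ :=
  (∑ x : Fin n → ℤˣ, ∑ z ∈ hSphere n r, f x * f (x * z)) / (2 ^ n * (hSphere n r).card)

/-- i.i.d.-noise stability `E[f(X) f(X∘Z)]`, `Z` with i.i.d. coordinates equal to `-1`
with probability `β` and `1` with probability `1-β`. -/
def Stab (n : ℕ) (β : ℝ) (f : (Fin n → ℤˣ) → ℝ) : ℝ :=
  (∑ x : Fin n → ℤˣ, ∑ z : Fin n → ℤˣ,
      (∏ i, if z i = 1 then 1 - β else β) * (f x * f (x * z))) / 2 ^ n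

/-- Indicator function of a set `A` of vertices. -/
def indic (n : ℕ) (A : Finset (Fin n → ℤˣ)) : (Fin n → ℤˣ) → ℝ :=
  fun x => if x ∈ A then 1 else 0

/-- `Γ_B^(n)(M,r)`: maximal ball-noise stability over Boolean functions with exactly `M` ones. -/
def GammaB (n M r : ℕ) : ℝ :=
  sSup {y | ∃ A : Finset (Fin n → ℤˣ), A.card = M ∧ y = BStab n r (indic n A)}

/-- `Γ_S^(n)(M,r)`: maximal sphere-noise stability over Boolean functions with exactly `M` ones. -/
def GammaS (n M r : ℕ) : ℝ :=
  sSup {y | ∃ A : Finset (Fin n → ℤˣ), A.card = M ∧ y = SStab n r (indic n A)}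

/-- `Γ_IID^(n)(M,β)`: maximal i.i.d.-noise stability over Boolean functions with exactly `M` ones. -/
def GammaIID (n M : ℕ) (β : ℝ) : ℝ :=
  sSup {y | ∃ A : Finset (Fin n → ℤˣ), A.card = M ∧ y = Stab n β (indic n A)}

/-- `Γ_IID(α,β) := sup_n Γ_IID^(n)(⌊α·2^n⌋, β)` (equivalently the limit, by monotonicity). -/
def GammaIIDlim (α β : ℝ) : ℝ := ⨆ n : ℕ, GammaIID n ⌊α * 2 ^ n⌋₊ β

/-- `C(n, ≤ r) = Σ_{i=0}^r C(n,i)`. -/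
def ballBinom (n r : ℕ) : ℕ := ∑ i ∈ Finset.range (r + 1), n.choose i

open Filter

/-- The Walsh character `z ↦ ∏_{i ∈ S} z_i` as a real-valued function. -/
def walsh {n : ℕ} (S : Finset (Fin n)) (z : Fin n → ℤˣ) : ℝ := ∏ i ∈ S, ((z i : ℤ) : ℝ)

/-- The (unnormalized) Walsh coefficient `∑_x f(x) χ_S(x)`. -/
def walshCoef {n : ℕ} (f : (Fin n → ℤˣ) → ℝ) (S : Finset (Fin n)) : ℝ := ∑ x, f x * walsh S x

/-- The mean of the Walsh character `χ_S` over the Hamming sphere of radius `r`. -/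
def sphereMean {n : ℕ} (r : ℕ) (S : Finset (Fin n)) : ℝ :=
  (∑ z ∈ hSphere n r, walsh S z) / (hSphere n r).card

lemma cast_sq_eq_one (u : ℤˣ) : ((u : ℤ) : ℝ) * ((u : ℤ) : ℝ) = 1 := by
  rcases Int.units_eq_one_or u with rfl | rfl <;> norm_num

lemma abs_cast_eq_one (u : ℤˣ) : |((u : ℤ) : ℝ)| = 1 := by
  rcases Int.units_eq_one_or u with rfl | rfl <;> norm_num

lemma walsh_mul {n : ℕ} (S : Finset (Fin n)) (x y : Fin n → ℤˣ) :
    walsh S (x * y) = walsh S x * walsh S y := by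
  simp [walsh, Finset.prod_mul_distrib]

lemma abs_walsh {n : ℕ} (S : Finset (Fin n)) (x : Fin n → ℤˣ) : |walsh S x| = 1 := by
  simp [walsh, Finset.abs_prod, abs_cast_eq_one]

lemma walsh_mul_self {n : ℕ} (S : Finset (Fin n)) (x : Fin n → ℤˣ) :
    walsh S x * walsh S x = 1 := by
  rw [← abs_mul_abs_self, abs_walsh, one_mul]

lemma walsh_compl {n : ℕ} (S : Finset (Fin n)) (x : Fin n → ℤˣ) :
    walsh Sᶜ x = walsh univ x * walsh S x := by
  have h : walsh S x * walsh Sᶜ x = walsh univ x := Finset.prod_mul_prod_compl S _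
  rw [← h, mul_right_comm, walsh_mul_self, one_mul]

lemma sum_walsh {n : ℕ} (y : Fin n → ℤˣ) :
    ∑ S : Finset (Fin n), walsh S y = if y = 1 then 2 ^ n else 0 := by
  have h : ∏ i, (1 + ((y i : ℤ) : ℝ)) = ∑ S : Finset (Fin n), walsh S y := by
    rw [Finset.prod_one_add, Finset.powerset_univ]; rfl
  rw [← h]
  split_ifs with hy
  · subst hy; norm_num
  · obtain ⟨i, hi⟩ : ∃ i, y i ≠ 1 := by
      by_contra! hc
      exact hy (funext hc)
    have hi' : y i = -1 := (Int.units_eq_one_or (y i)).resolve_left hi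
    exact Finset.prod_eq_zero (mem_univ i) (by simp [hi'])

lemma sum_walshCoef_sq_mul {n : ℕ} (f : (Fin n → ℤˣ) → ℝ) (z : Fin n → ℤˣ) :
    ∑ S, walshCoef f S ^ 2 * walsh S z = 2 ^ n * ∑ x, f x * f (x * z) := by
  have h1 : ∀ S, walshCoef f S ^ 2 * walsh S z =
      ∑ x, ∑ y, f x * f y * walsh S (x * y * z) := by
    intro S
    rw [sq, walshCoef, Finset.sum_mul_sum, Finset.sum_mul]
    refine Finset.sum_congr rfl fun x _ => ?_
    rw [Finset.sum_mul]
    refine Finset.sum_congr rfl fun y _ => ?_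
    rw [walsh_mul, walsh_mul]; ring
  simp_rw [h1]
  rw [Finset.sum_comm, Finset.mul_sum]
  refine Finset.sum_congr rfl fun x _ => ?_
  rw [Finset.sum_comm]
  simp_rw [← Finset.mul_sum, sum_walsh]
  have hinv : ∀ u : Fin n → ℤˣ, u * u = 1 := fun u => funext fun i => Int.units_mul_self (u i)
  rw [Finset.sum_eq_single (x * z)]
  · rw [if_pos]
    · ring
    · rw [mul_assoc, mul_assoc, hinv, mul_one, hinv]
  · intro y _ hy
    rw [if_neg, mul_zero]
    intro h
    apply hy
    calc y = x * x * y * (z * z) := by rw [hinv, hinv]; simp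
      _ = (x * y * z) * (x * z) := by ac_rfl
      _ = x * z := by rw [h, one_mul]
  · simp

lemma SStab_eq_sum {n : ℕ} (r : ℕ) (f : (Fin n → ℤˣ) → ℝ) :
    SStab n r f = (∑ S, walshCoef f S ^ 2 * sphereMean r S) / 4 ^ n := by
  have h : ∑ S, walshCoef f S ^ 2 * sphereMean r S =
      2 ^ n * (∑ x, ∑ z ∈ hSphere n r, f x * f (x * z)) / (hSphere n r).card := by
    simp_rw [sphereMean, mul_div_assoc', ← Finset.sum_div, Finset.mul_sum]
    rw [Finset.sum_comm]
    simp_rw [sum_walshCoef_sq_mul]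
    rw [← Finset.mul_sum, Finset.sum_comm, Finset.mul_sum]
    simp_rw [Finset.mul_sum]
  rw [h, SStab, show (4 : ℝ) ^ n = 2 ^ n * 2 ^ n by rw [← mul_pow]; norm_num]
  rw [div_div, mul_comm ((hSphere n r).card : ℝ), mul_assoc, mul_div_mul_left _ _ (by positivity)]

lemma sum_weight_mul_walsh {n : ℕ} (β : ℝ) (S : Finset (Fin n)) :
    ∑ z : Fin n → ℤˣ, (∏ i, if z i = 1 then 1 - β else β) * walsh S z =
      (1 - 2 * β) ^ S.card := by
  have h : ∀ z : Fin n → ℤˣ, (∏ i, if z i = 1 then 1 - β else β) * walsh S z =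
      ∏ i, ((if z i = 1 then 1 - β else β) * if i ∈ S then ((z i : ℤ) : ℝ) else 1) := by
    intro z
    rw [Finset.prod_mul_distrib, walsh, Finset.prod_ite_mem, Finset.univ_inter]
  simp_rw [h]
  rw [← Fintype.piFinset_univ, ← Finset.prod_univ_sum (fun _ => univ)
    (fun i (u : ℤˣ) => (if u = 1 then 1 - β else β) * if i ∈ S then ((u : ℤ) : ℝ) else 1)]
  have h2 : ∀ i : Fin n, (∑ u : ℤˣ,
      (if u = 1 then 1 - β else β) * if i ∈ S then ((u : ℤ) : ℝ) else 1) =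
      if i ∈ S then 1 - 2 * β else 1 := by
    intro i
    rw [show (univ : Finset ℤˣ) = {1, -1} from rfl, Finset.sum_pair (by decide)]
    split_ifs <;> simp_all
    ring
  simp_rw [h2]
  rw [Finset.prod_ite_mem, Finset.univ_inter, Finset.prod_const]

lemma Stab_eq_sum {n : ℕ} (β : ℝ) (f : (Fin n → ℤˣ) → ℝ) :
    Stab n β f = (∑ S, walshCoef f S ^ 2 * (1 - 2 * β) ^ S.card) / 4 ^ n := by
  have h : ∑ S, walshCoef f S ^ 2 * (1 - 2 * β) ^ S.card =
      2 ^ n * ∑ x : Fin n → ℤˣ, ∑ z : Fin n → ℤˣ,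
        (∏ i, if z i = 1 then 1 - β else β) * (f x * f (x * z)) := by
    simp_rw [← sum_weight_mul_walsh, Finset.mul_sum]
    rw [Finset.sum_comm, Finset.sum_comm (s := univ) (t := univ) (f := fun x z => 2 ^ n * _)]
    refine Finset.sum_congr rfl fun z _ => ?_
    simp_rw [mul_left_comm _ (∏ i, if z i = 1 then 1 - β else β)]
    rw [← Finset.mul_sum, sum_walshCoef_sq_mul, ← Finset.mul_sum, Finset.mul_sum]
  rw [h, Stab, show (4 : ℝ) ^ n = 2 ^ n * 2 ^ n by rw [← mul_pow]; norm_num,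
    mul_div_mul_left _ _ (by positivity)]

lemma sum_walshCoef_sq_le {n : ℕ} (f : (Fin n → ℤˣ) → ℝ) (hf : ∀ x, |f x| ≤ 1) :
    ∑ S, walshCoef f S ^ 2 ≤ 4 ^ n := by
  have h := sum_walshCoef_sq_mul f 1
  simp only [walsh, Pi.one_apply, Units.val_one, Int.cast_one, Finset.prod_const_one, mul_one] at h
  have hs : ∑ x, f x * f x ≤ 2 ^ n := by
    calc ∑ x, f x * f x ≤ ∑ _x : Fin n → ℤˣ, (1 : ℝ) := by
          refine Finset.sum_le_sum fun x _ => ?_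
          rw [← abs_mul_abs_self]
          exact mul_le_one₀ (hf x) (abs_nonneg _) (hf x)
      _ = 2 ^ n := by simp
  rw [h, show (4 : ℝ) ^ n = 2 ^ n * 2 ^ n by rw [← mul_pow]; norm_num]
  gcongr

lemma mem_hSphere {n r : ℕ} {z : Fin n → ℤˣ} :
    z ∈ hSphere n r ↔ #{i | z i ≠ 1} = r := by
  simp [hSphere, hammingDist]

lemma sum_hSphere_comp {n r : ℕ} (σ : Equiv.Perm (Fin n)) (g : (Fin n → ℤˣ) → ℝ) :
    ∑ z ∈ hSphere n r, g (z ∘ σ) = ∑ z ∈ hSphere n r, g z := by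
  refine Finset.sum_equiv (σ.symm.arrowCongr (Equiv.refl ℤˣ)) (fun z => ?_) (fun z _ => rfl)
  have h : #{i | z (σ i) ≠ 1} = #{i | z i ≠ 1} :=
    Finset.card_bij (fun i _ => σ i) (by simp) (by simp)
      (fun b hb => ⟨σ.symm b, by simpa using hb, by simp⟩)
  simp only [mem_hSphere, ← h]
  rfl

lemma card_hSphere_pos {n r : ℕ} (h : r ≤ n) : 0 < (hSphere n r).card := by
  refine Finset.card_pos.2 ⟨fun i => if i.val < r then -1 else 1, mem_hSphere.2 ?_⟩
  have h1 : ∀ i : Fin n, (if i.val < r then (-1 : ℤˣ) else 1) ≠ 1 ↔ i.val < r := by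
    intro i
    split_ifs with hi <;> simp [hi]
  simp_rw [h1]
  rw [Fin.card_filter_val_lt, min_eq_right h]

lemma sphereMean_eq_of_card_eq {n : ℕ} (r : ℕ) {S T : Finset (Fin n)} (h : S.card = T.card) :
    sphereMean r S = sphereMean r T := by
  obtain ⟨σ, rfl⟩ : ∃ σ : Equiv.Perm (Fin n), S.map σ.toEmbedding = T := by
    let e : {x // x ∈ S} ≃ {x // x ∈ T} := Finset.equivOfCardEq h
    refine ⟨e.extendSubtype, Finset.eq_of_subset_of_card_le (fun x hx => ?_) (by simp [h])⟩
    obtain ⟨y, hy, rfl⟩ := Finset.mem_map.1 hx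
    exact e.extendSubtype_mem y hy
  have hw : ∀ z : Fin n → ℤˣ, walsh (S.map σ.toEmbedding) z = walsh S (z ∘ σ) := by
    intro z
    rw [walsh, Finset.prod_map]
    rfl
  simp_rw [sphereMean, hw, sum_hSphere_comp σ (walsh S)]

/-- The mean of a Walsh character of degree `k` over the Hamming sphere of radius `r`, that is,
the normalized Krawtchouk polynomial. -/
def krawt (n r k : ℕ) : ℝ := sphereMean r (univ.filter fun i : Fin n => i.val < k)

lemma sphereMean_eq_krawt {n : ℕ} (r : ℕ) (S : Finset (Fin n)) :
    sphereMean r S = krawt n r S.card := by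
  refine sphereMean_eq_of_card_eq r ?_
  rw [Fin.card_filter_val_lt, min_eq_right]
  simpa using S.card_le_univ

lemma krawt_zero {n r : ℕ} (h : r ≤ n) : krawt n r 0 = 1 := by
  have h0 : ((hSphere n r).card : ℝ) ≠ 0 := by exact_mod_cast (card_hSphere_pos h).ne'
  simp [krawt, sphereMean, walsh, h0]

lemma sum_coord_of_mem_hSphere {n r : ℕ} {z : Fin n → ℤˣ} (hz : z ∈ hSphere n r) :
    ∑ i, ((z i : ℤ) : ℝ) = n - 2 * r := by
  have h : ∀ i, ((z i : ℤ) : ℝ) = 1 - 2 * if z i ≠ 1 then 1 else 0 := by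
    intro i
    rcases Int.units_eq_one_or (z i) with h | h <;> simp [h]
    norm_num
  simp_rw [h]
  rw [Finset.sum_sub_distrib, ← Finset.mul_sum, Finset.sum_boole, mem_hSphere.1 hz]
  simp

lemma krawt_recurrence {n r k : ℕ} (hk : k < n) :
    (n - 2 * r) * krawt n r k = k * krawt n r (k - 1) + (n - k) * krawt n r (k + 1) := by
  set S : Finset (Fin n) := univ.filter fun i : Fin n => i.val < k with hS
  have hc : S.card = k := by rw [hS, Fin.card_filter_val_lt, min_eq_right hk.le]
  have hmul : ∀ z : Fin n → ℤˣ, (∑ i, ((z i : ℤ) : ℝ)) * walsh S z =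
      ∑ i ∈ S, walsh (S.erase i) z + ∑ i ∈ Sᶜ, walsh (insert i S) z := by
    intro z
    rw [← Finset.sum_add_sum_compl S, add_mul, Finset.sum_mul, Finset.sum_mul]
    congr 1
    · refine Finset.sum_congr rfl fun i hi => ?_
      rw [walsh, ← Finset.mul_prod_erase S _ hi, ← mul_assoc, cast_sq_eq_one, one_mul, walsh]
    · refine Finset.sum_congr rfl fun i hi => ?_
      rw [walsh, walsh, Finset.prod_insert (Finset.mem_compl.1 hi)]
  have hsum : (n - 2 * r) * ∑ z ∈ hSphere n r, walsh S z =
      ∑ i ∈ S, ∑ z ∈ hSphere n r, walsh (S.erase i) z +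
        ∑ i ∈ Sᶜ, ∑ z ∈ hSphere n r, walsh (insert i S) z := by
    rw [Finset.sum_comm (s := S), Finset.sum_comm (s := Sᶜ), ← Finset.sum_add_distrib,
      Finset.mul_sum]
    refine Finset.sum_congr rfl fun z hz => ?_
    rw [← hmul, sum_coord_of_mem_hSphere hz]
  have hmean : (n - 2 * r) * sphereMean r S =
      ∑ i ∈ S, sphereMean r (S.erase i) + ∑ i ∈ Sᶜ, sphereMean r (insert i S) := by
    simp_rw [sphereMean]
    rw [← Finset.sum_div, ← Finset.sum_div, ← add_div, mul_div_assoc', hsum]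
  rw [sphereMean_eq_krawt, hc] at hmean
  rw [hmean]
  congr 1
  · rw [Finset.sum_congr rfl fun i hi => by
      rw [sphereMean_eq_krawt, Finset.card_erase_of_mem hi, hc]]
    simp [hc]
  · rw [Finset.sum_congr rfl fun i hi => by
      rw [sphereMean_eq_krawt, Finset.card_insert_of_notMem (Finset.mem_compl.1 hi), hc]]
    rw [Finset.sum_const, Finset.card_compl, hc, Fintype.card_fin, nsmul_eq_mul,
      Nat.cast_sub hk.le]

lemma tendsto_krawt {r : ℕ → ℕ} {β : ℝ} (hr : ∀ n, r n ≤ n)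
    (hlim : Tendsto (fun n : ℕ => (r n : ℝ) / n) atTop (nhds β)) (k : ℕ) :
    Tendsto (fun n => krawt n (r n) k) atTop (nhds ((1 - 2 * β) ^ k)) := by
  induction k using Nat.strong_induction_on with
  | _ k ih =>
    rcases k with _ | k
    · simpa using tendsto_const_nhds.congr fun n => (krawt_zero (hr n)).symm
    · have hk : Tendsto (fun n : ℕ => (k : ℝ) / n) atTop (nhds 0) :=
        tendsto_const_div_atTop_nhds_zero_nat _
      have hprev : Tendsto (fun n : ℕ => (k : ℝ) / n * krawt n (r n) (k - 1)) atTop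
          (nhds 0) := by
        simpa using hk.mul (ih (k - 1) (by omega))
      have hnum := (((tendsto_const_nhds (x := (1 : ℝ))).sub (hlim.const_mul 2)).mul
        (ih k (by omega))).sub hprev
      have hden := (tendsto_const_nhds (x := (1 : ℝ))).sub hk
      have h := hnum.div hden (by simp)
      rw [sub_zero, sub_zero, div_one, ← pow_succ'] at h
      refine h.congr' ?_
      filter_upwards [eventually_gt_atTop k] with n hn
      have hrec := krawt_recurrence (r := r n) hn
      have hn0 : (0 : ℝ) < n := by exact_mod_cast (Nat.zero_le k).trans_lt hn
      have hnk : (0 : ℝ) < n - k := by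
        rw [sub_pos]; exact_mod_cast hn
      have h1 : (1 : ℝ) - k / n = (n - k) / n := by field_simp
      simp only [Pi.div_apply]
      rw [h1, div_eq_iff (by positivity)]
      field_simp
      linarith

lemma walsh_comp_swap {n : ℕ} {S : Finset (Fin n)} {a b : Fin n} (ha : a ∈ S) (hb : b ∉ S)
    (z : Fin n → ℤˣ) :
    walsh S (z ∘ Equiv.swap a b) = walsh S z * (((z a : ℤ) : ℝ) * ((z b : ℤ) : ℝ)) := by
  have hprod : ∏ i ∈ S.erase a, ((((z ∘ Equiv.swap a b) i : ℤˣ) : ℤ) : ℝ) =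
      ∏ i ∈ S.erase a, ((z i : ℤ) : ℝ) := by
    refine Finset.prod_congr rfl fun i hi => ?_
    obtain ⟨hia, hiS⟩ := Finset.mem_erase.1 hi
    rw [Function.comp_apply, Equiv.swap_apply_of_ne_of_ne hia (ne_of_mem_of_not_mem hiS hb)]
  rw [walsh, walsh, ← Finset.mul_prod_erase S _ ha, hprod, ← Finset.mul_prod_erase S _ ha,
    Function.comp_apply, Equiv.swap_apply_left]
  linear_combination (-((z b : ℤ) : ℝ) * ∏ i ∈ S.erase a, ((z i : ℤ) : ℝ)) * cast_sq_eq_one (z a)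

/-- Averaging over transpositions that exchange a point of `S` with a point outside `S`. -/
lemma sum_walsh_mul_prod_pairs {n r m : ℕ} {S : Finset (Fin n)} (s t : Fin m ↪ Fin n)
    (hs : ∀ i, s i ∈ S) (ht : ∀ i, t i ∉ S) (J : Finset (Fin m)) :
    ∑ z ∈ hSphere n r, walsh S z *
      ∏ i ∈ J, (1 + ((z (s i) : ℤ) : ℝ) * ((z (t i) : ℤ) : ℝ)) / 2 =
      ∑ z ∈ hSphere n r, walsh S z := by
  induction J using Finset.induction_on with
  | empty => simp
  | insert a J haJ ih =>
    have hinv : ∀ z : Fin n → ℤˣ, ∀ i ∈ J,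
        (z ∘ Equiv.swap (s a) (t a)) (s i) = z (s i) ∧
          (z ∘ Equiv.swap (s a) (t a)) (t i) = z (t i) := by
      intro z i hi
      have hia : i ≠ a := fun h => haJ (h ▸ hi)
      constructor
      · rw [Function.comp_apply, Equiv.swap_apply_of_ne_of_ne (s.injective.ne hia)
          (ne_of_mem_of_not_mem (hs i) (ht a))]
      · rw [Function.comp_apply, Equiv.swap_apply_of_ne_of_ne
          (ne_of_mem_of_not_mem (hs a) (ht i)).symm (t.injective.ne hia)]
    have hswap := sum_hSphere_comp (r := r) (Equiv.swap (s a) (t a)) fun z => walsh S z *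
      ∏ i ∈ J, (1 + ((z (s i) : ℤ) : ℝ) * ((z (t i) : ℤ) : ℝ)) / 2
    have hswap' : ∑ z ∈ hSphere n r,
        walsh S z * (((z (s a) : ℤ) : ℝ) * ((z (t a) : ℤ) : ℝ)) *
        ∏ i ∈ J, (1 + ((z (s i) : ℤ) : ℝ) * ((z (t i) : ℤ) : ℝ)) / 2 =
        ∑ z ∈ hSphere n r, walsh S z := by
      rw [← ih, ← hswap]
      refine Finset.sum_congr rfl fun z _ => ?_
      rw [walsh_comp_swap (hs a) (ht a)]
      congr 1
      refine Finset.prod_congr rfl fun i hi => ?_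
      rw [(hinv z i hi).1, (hinv z i hi).2]
    have hsplit : ∀ z : Fin n → ℤˣ, walsh S z *
        ∏ i ∈ insert a J, (1 + ((z (s i) : ℤ) : ℝ) * ((z (t i) : ℤ) : ℝ)) / 2 =
        1 / 2 * (walsh S z * ∏ i ∈ J, (1 + ((z (s i) : ℤ) : ℝ) * ((z (t i) : ℤ) : ℝ)) / 2) +
        1 / 2 * (walsh S z * (((z (s a) : ℤ) : ℝ) * ((z (t a) : ℤ) : ℝ)) *
          ∏ i ∈ J, (1 + ((z (s i) : ℤ) : ℝ) * ((z (t i) : ℤ) : ℝ)) / 2) := by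
      intro z
      rw [Finset.prod_insert haJ]; ring
    rw [Finset.sum_congr rfl fun z _ => hsplit z, Finset.sum_add_distrib, ← Finset.mul_sum,
      ← Finset.mul_sum, ih, hswap']
    ring

/-- The probability that none of `m` disjoint pairs of coordinates is separated by a uniform
point of the Hamming sphere bounds the characters of degree between `m` and `n - m`. -/
lemma sphereMean_le_pairs {n r m : ℕ} {S : Finset (Fin n)} (hm : m ≤ S.card)
    (hm' : m ≤ Sᶜ.card) :
    sphereMean r S ≤ (∑ T : Finset (Fin m), krawt n r (2 * T.card)) / 2 ^ m := by
  obtain ⟨s, hs⟩ : ∃ s : Fin m ↪ Fin n, ∀ i, s i ∈ S :=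
    ⟨(Fin.castLEEmb hm).trans (S.equivFin.symm.toEmbedding.trans (Function.Embedding.subtype _)),
      fun i => (S.equivFin.symm _).2⟩
  obtain ⟨t, ht⟩ : ∃ t : Fin m ↪ Fin n, ∀ i, t i ∈ Sᶜ :=
    ⟨(Fin.castLEEmb hm').trans
      (Sᶜ.equivFin.symm.toEmbedding.trans (Function.Embedding.subtype _)),
      fun i => (Sᶜ.equivFin.symm _).2⟩
  have hdisj : ∀ T : Finset (Fin m), Disjoint (T.map s) (T.map t) := by
    intro T
    refine Finset.disjoint_left.2 fun x hx hx' => ?_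
    obtain ⟨i, -, rfl⟩ := Finset.mem_map.1 hx
    obtain ⟨j, -, hj⟩ := Finset.mem_map.1 hx'
    exact Finset.mem_compl.1 (ht j) (hj ▸ hs i)
  have hk : ∀ T : Finset (Fin m), krawt n r (2 * T.card) =
      (∑ z ∈ hSphere n r, ∏ i ∈ T, (((z (s i) : ℤ) : ℝ) * ((z (t i) : ℤ) : ℝ))) /
        (hSphere n r).card := by
    intro T
    have hc : (T.map s ∪ T.map t).card = 2 * T.card := by
      rw [Finset.card_union_of_disjoint (hdisj T)]; simp [two_mul]
    rw [← hc, ← sphereMean_eq_krawt, sphereMean]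
    congr 1
    refine Finset.sum_congr rfl fun z _ => ?_
    rw [walsh, Finset.prod_union (hdisj T), Finset.prod_map, Finset.prod_map,
      Finset.prod_mul_distrib]
  have hbound : ∑ z ∈ hSphere n r, walsh S z ≤
      (∑ z ∈ hSphere n r, ∑ T : Finset (Fin m),
        ∏ i ∈ T, (((z (s i) : ℤ) : ℝ) * ((z (t i) : ℤ) : ℝ))) / 2 ^ m := by
    rw [← sum_walsh_mul_prod_pairs s t hs (fun i => Finset.mem_compl.1 (ht i)) univ,
      Finset.sum_div]
    refine Finset.sum_le_sum fun z _ => ?_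
    have hexp : (∑ T : Finset (Fin m),
        ∏ i ∈ T, (((z (s i) : ℤ) : ℝ) * ((z (t i) : ℤ) : ℝ))) / 2 ^ m =
        ∏ i, (1 + ((z (s i) : ℤ) : ℝ) * ((z (t i) : ℤ) : ℝ)) / 2 := by
      rw [Finset.prod_div_distrib, Finset.prod_one_add, Finset.powerset_univ]
      simp
    rw [hexp]
    refine mul_le_of_le_one_left (Finset.prod_nonneg fun i _ => ?_)
      ((le_abs_self _).trans (abs_walsh S z).le)
    have h : |((z (s i) : ℤ) : ℝ) * ((z (t i) : ℤ) : ℝ)| = 1 := by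
      rw [abs_mul, abs_cast_eq_one, abs_cast_eq_one, one_mul]
    linarith [(abs_le.1 h.le).1]
  calc sphereMean r S ≤ _ := div_le_div_of_nonneg_right hbound (Nat.cast_nonneg _)
    _ = _ := by
      simp_rw [hk]
      rw [← Finset.sum_div, Finset.sum_comm, div_right_comm]

lemma walsh_univ_of_mem_hSphere {n r : ℕ} (hr : Even r) {z : Fin n → ℤˣ}
    (hz : z ∈ hSphere n r) : walsh univ z = 1 := by
  have h : ∀ i, ((z i : ℤ) : ℝ) = if z i ≠ 1 then -1 else 1 := by
    intro i
    rcases Int.units_eq_one_or (z i) with h | h <;> simp [h]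
  simp_rw [walsh, h]
  rw [Finset.prod_ite, Finset.prod_const, Finset.prod_const_one, mul_one, mem_hSphere.1 hz,
    hr.neg_one_pow]

lemma sphereMean_compl {n r : ℕ} (hr : Even r) (S : Finset (Fin n)) :
    sphereMean r Sᶜ = sphereMean r S := by
  rw [sphereMean, sphereMean]
  congr 1
  refine Finset.sum_congr rfl fun z hz => ?_
  rw [walsh_compl, walsh_univ_of_mem_hSphere hr hz, one_mul]

lemma eventually_sphereMean_le {r : ℕ → ℕ} {β : ℝ} (hr : ∀ n, r n ≤ n) (heven : ∀ n, Even (r n))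
    (hlim : Tendsto (fun n : ℕ => (r n : ℝ) / n) atTop (nhds β)) (hβ0 : 0 < β)
    (hβ1 : β ≤ 1 / 2) {ε : ℝ} (hε : 0 < ε) :
    ∀ᶠ n in atTop, ∀ S : Finset (Fin n),
      sphereMean (r n) S ≤ (1 - 2 * β) ^ S.card + (1 - 2 * β) ^ Sᶜ.card + ε := by
  set ρ : ℝ := 1 - 2 * β with hρ
  have hρ0 : 0 ≤ ρ := by linarith
  have hρ1 : ρ < 1 := by linarith
  have hq : (1 + ρ ^ 2) / 2 < 1 := by nlinarith
  obtain ⟨m, hm⟩ := exists_pow_lt_of_lt_one hε hq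
  have hpairs : Tendsto (fun n => (∑ T : Finset (Fin m), krawt n (r n) (2 * T.card)) / 2 ^ m)
      atTop (nhds (((1 + ρ ^ 2) / 2) ^ m)) := by
    have h := (tendsto_finsetSum (univ : Finset (Finset (Fin m)))
      fun T _ => tendsto_krawt hr hlim (2 * T.card)).div_const (2 ^ m)
    convert h using 2
    have hsum := Finset.prod_one_add (f := fun _ : Fin m => ρ ^ 2) univ
    rw [Finset.powerset_univ] at hsum
    simp only [Finset.prod_const, Finset.card_univ, Fintype.card_fin, ← pow_mul] at hsum
    rw [div_pow, hsum]
  have hlow : ∀ᶠ n in atTop, ∀ k ∈ Finset.range m, krawt n (r n) k < ρ ^ k + ε := by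
    rw [Filter.eventually_all_finset]
    intro k _
    exact (tendsto_krawt hr hlim k).eventually_lt_const (by linarith)
  filter_upwards [hpairs.eventually_lt_const hm, hlow] with n h1 h2 S
  have p1 : 0 ≤ ρ ^ S.card := pow_nonneg hρ0 _
  have p2 : 0 ≤ ρ ^ Sᶜ.card := pow_nonneg hρ0 _
  rcases lt_or_ge S.card m with hS | hS
  · have h := h2 _ (Finset.mem_range.2 hS)
    rw [← sphereMean_eq_krawt] at h
    linarith
  rcases lt_or_ge Sᶜ.card m with hS' | hS'
  · have h := h2 _ (Finset.mem_range.2 hS')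
    rw [← sphereMean_eq_krawt, sphereMean_compl (heven n)] at h
    linarith
  linarith [sphereMean_le_pairs (r := r n) hS hS']

lemma indic_nonneg {n : ℕ} (A : Finset (Fin n → ℤˣ)) (x : Fin n → ℤˣ) : 0 ≤ indic n A x := by
  rw [indic]; split_ifs <;> norm_num

lemma indic_le_one {n : ℕ} (A : Finset (Fin n → ℤˣ)) (x : Fin n → ℤˣ) : indic n A x ≤ 1 := by
  rw [indic]; split_ifs <;> norm_num

lemma abs_indic_le_one {n : ℕ} (A : Finset (Fin n → ℤˣ)) (x : Fin n → ℤˣ) :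
    |indic n A x| ≤ 1 := by
  rw [abs_of_nonneg (indic_nonneg A x)]
  exact indic_le_one A x

lemma sum_indic {n : ℕ} (A : Finset (Fin n → ℤˣ)) : ∑ x, indic n A x = A.card := by
  simp [indic]

lemma SStab_indic_nonneg {n r : ℕ} (A : Finset (Fin n → ℤˣ)) : 0 ≤ SStab n r (indic n A) :=
  div_nonneg (Finset.sum_nonneg fun x _ => Finset.sum_nonneg fun z _ =>
    mul_nonneg (indic_nonneg A x) (indic_nonneg A _)) (by positivity)

lemma SStab_indic_mono {n r : ℕ} {A B : Finset (Fin n → ℤˣ)} (h : A ⊆ B) :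
    SStab n r (indic n A) ≤ SStab n r (indic n B) := by
  have hle : ∀ x, indic n A x ≤ indic n B x := by
    intro x
    simp only [indic]
    split_ifs with h1 h2 <;> first | exact absurd (h h1) h2 | norm_num
  rw [SStab, SStab]
  gcongr with x _ z _
  · exact indic_nonneg _ _
  · exact indic_nonneg _ _
  · exact hle _
  · exact hle _

lemma SStab_indic_le_one {n r : ℕ} (A : Finset (Fin n → ℤˣ)) : SStab n r (indic n A) ≤ 1 := by
  refine div_le_one_of_le₀ ?_ (by positivity)
  calc ∑ x : Fin n → ℤˣ, ∑ z ∈ hSphere n r, indic n A x * indic n A (x * z)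
      ≤ ∑ _x : Fin n → ℤˣ, ∑ _z ∈ hSphere n r, (1 : ℝ) :=
        Finset.sum_le_sum fun x _ => Finset.sum_le_sum fun z _ =>
          mul_le_one₀ (indic_le_one A x) (indic_nonneg A _) (indic_le_one A _)
    _ = 2 ^ n * (hSphere n r).card := by simp

lemma Stab_indic_nonneg {n : ℕ} {β : ℝ} (hβ1 : β ≤ 1 / 2) (A : Finset (Fin n → ℤˣ)) :
    0 ≤ Stab n β (indic n A) := by
  rw [Stab_eq_sum]
  have hρ : 0 ≤ 1 - 2 * β := by linarith
  positivity

lemma Stab_indic_le_one {n : ℕ} {β : ℝ} (hβ0 : 0 < β) (hβ1 : β ≤ 1 / 2)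
    (A : Finset (Fin n → ℤˣ)) : Stab n β (indic n A) ≤ 1 := by
  rw [Stab_eq_sum]
  refine div_le_one_of_le₀ (le_trans (Finset.sum_le_sum fun S _ => ?_)
    (sum_walshCoef_sq_le _ (abs_indic_le_one A))) (by positivity)
  exact mul_le_of_le_one_right (sq_nonneg _) (pow_le_one₀ (by linarith) (by linarith))

lemma GammaS_nonneg (n M r : ℕ) : 0 ≤ GammaS n M r :=
  Real.sSup_nonneg (by rintro _ ⟨A, -, rfl⟩; exact SStab_indic_nonneg A)

lemma GammaS_le_one (n M r : ℕ) : GammaS n M r ≤ 1 :=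
  Real.sSup_le (by rintro _ ⟨A, -, rfl⟩; exact SStab_indic_le_one A) zero_le_one

lemma SStab_indic_le_GammaS {n M r : ℕ} (hM : M ≤ 2 ^ n) {B : Finset (Fin n → ℤˣ)}
    (hB : B.card ≤ M) : SStab n r (indic n B) ≤ GammaS n M r := by
  obtain ⟨C, hBC, -, hC⟩ := Finset.exists_subsuperset_card_eq (Finset.subset_univ B) hB
    (by simpa using hM)
  refine (SStab_indic_mono hBC).trans (le_csSup ⟨1, ?_⟩ ⟨C, hC, rfl⟩)
  rintro _ ⟨A, -, rfl⟩
  exact SStab_indic_le_one A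

lemma GammaIID_nonneg {n M : ℕ} {β : ℝ} (hβ1 : β ≤ 1 / 2) : 0 ≤ GammaIID n M β :=
  Real.sSup_nonneg (by rintro _ ⟨A, -, rfl⟩; exact Stab_indic_nonneg hβ1 A)

lemma GammaIIDlim_nonneg {α β : ℝ} (hβ1 : β ≤ 1 / 2) : 0 ≤ GammaIIDlim α β :=
  Real.iSup_nonneg fun _ => GammaIID_nonneg hβ1

lemma Stab_indic_le_GammaIIDlim {n : ℕ} {α β : ℝ} (hβ0 : 0 < β) (hβ1 : β ≤ 1 / 2)
    {A : Finset (Fin n → ℤˣ)} (hA : A.card = ⌊α * 2 ^ n⌋₊) :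
    Stab n β (indic n A) ≤ GammaIIDlim α β := by
  have h1 : Stab n β (indic n A) ≤ GammaIID n ⌊α * 2 ^ n⌋₊ β := by
    refine le_csSup ⟨1, ?_⟩ ⟨A, hA, rfl⟩
    rintro _ ⟨B, -, rfl⟩
    exact Stab_indic_le_one hβ0 hβ1 B
  refine h1.trans (le_ciSup (f := fun n : ℕ => GammaIID n ⌊α * 2 ^ n⌋₊ β) ⟨1, ?_⟩ n)
  rintro _ ⟨k, rfl⟩
  exact Real.sSup_le (by rintro _ ⟨B, -, rfl⟩; exact Stab_indic_le_one hβ0 hβ1 B) zero_le_one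

lemma GammaIIDlim_le {α β b : ℝ} (hb : 0 ≤ b)
    (h : ∀ (m : ℕ) (A : Finset (Fin m → ℤˣ)), A.card = ⌊α * 2 ^ m⌋₊ →
      Stab m β (indic m A) ≤ b) : GammaIIDlim α β ≤ b :=
  ciSup_le fun m => Real.sSup_le (by rintro _ ⟨A, hA, rfl⟩; exact h m A hA) hb

lemma walshCoef_compl {n : ℕ} (f : (Fin n → ℤˣ) → ℝ) (S : Finset (Fin n)) :
    walshCoef f Sᶜ = walshCoef (fun x => f x * walsh univ x) S := by
  simp_rw [walshCoef, walsh_compl, mul_assoc]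

lemma Stab_mul_walsh_le {n : ℕ} {β : ℝ} (hβ0 : 0 < β) (hβ1 : β ≤ 1 / 2)
    (f : (Fin n → ℤˣ) → ℝ) (hf : ∀ x, 0 ≤ f x) :
    Stab n β (fun x => f x * walsh univ x) ≤ Stab n β f := by
  rw [Stab, Stab]
  refine div_le_div_of_nonneg_right (Finset.sum_le_sum fun x _ => Finset.sum_le_sum fun z _ =>
    mul_le_mul_of_nonneg_left ?_ (Finset.prod_nonneg fun i _ => ?_)) (by positivity)
  · calc f x * walsh univ x * (f (x * z) * walsh univ (x * z))
        = f x * f (x * z) * walsh univ z := by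
          rw [walsh_mul]
          linear_combination f x * f (x * z) * walsh univ z * walsh_mul_self univ x
      _ ≤ f x * f (x * z) := mul_le_of_le_one_right (mul_nonneg (hf _) (hf _))
          ((le_abs_self _).trans (abs_walsh _ _).le)
  · split_ifs <;> linarith

lemma eventually_SStab_le {r : ℕ → ℕ} {β : ℝ} (hr : ∀ n, r n ≤ n) (heven : ∀ n, Even (r n))
    (hlim : Tendsto (fun n : ℕ => (r n : ℝ) / n) atTop (nhds β)) (hβ0 : 0 < β)
    (hβ1 : β ≤ 1 / 2) {ε : ℝ} (hε : 0 < ε) :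
    ∀ᶠ n in atTop, ∀ A : Finset (Fin n → ℤˣ),
      SStab n (r n) (indic n A) ≤ 2 * Stab n β (indic n A) + ε := by
  filter_upwards [eventually_sphereMean_le hr heven hlim hβ0 hβ1 hε] with n hn A
  set f := indic n A
  have hc : ∑ S : Finset (Fin n), walshCoef f S ^ 2 * (1 - 2 * β) ^ Sᶜ.card =
      ∑ S : Finset (Fin n),
        walshCoef (fun x => f x * walsh univ x) S ^ 2 * (1 - 2 * β) ^ S.card := by
    refine Finset.sum_equiv (compl_involutive.toPerm _) (by simp) fun S _ => ?_
    rw [← walshCoef_compl, Function.Involutive.coe_toPerm, compl_compl]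
  have hle : ∑ S, walshCoef f S ^ 2 * sphereMean (r n) S ≤
      ∑ S, walshCoef f S ^ 2 * (1 - 2 * β) ^ S.card +
        ∑ S : Finset (Fin n), walshCoef f S ^ 2 * (1 - 2 * β) ^ Sᶜ.card +
        ε * ∑ S, walshCoef f S ^ 2 := by
    rw [Finset.mul_sum, ← Finset.sum_add_distrib, ← Finset.sum_add_distrib]
    refine Finset.sum_le_sum fun S _ => ?_
    have := mul_le_mul_of_nonneg_left (hn S) (sq_nonneg (walshCoef f S))
    linarith
  have hpars : ε * ∑ S, walshCoef f S ^ 2 ≤ ε * 4 ^ n :=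
    mul_le_mul_of_nonneg_left (sum_walshCoef_sq_le f (abs_indic_le_one A)) hε.le
  calc SStab n (r n) f ≤ Stab n β f + Stab n β (fun x => f x * walsh univ x) + ε := by
        rw [SStab_eq_sum, Stab_eq_sum, Stab_eq_sum, ← hc, ← add_div, div_add' _ _ _ (by positivity)]
        exact div_le_div_of_nonneg_right (hle.trans (by linarith)) (by positivity)
    _ ≤ 2 * Stab n β f + ε := by
        linarith [Stab_mul_walsh_le hβ0 hβ1 f (indic_nonneg A)]

/-- Restriction of a point of the `n`-cube to its first `m` coordinates. -/
def cubeRestrict {m n : ℕ} (h : m ≤ n) : (Fin n → ℤˣ) →* (Fin m → ℤˣ) where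
  toFun x i := x (Fin.castLE h i)
  map_one' := rfl
  map_mul' _ _ := rfl

lemma cubeRestrict_surjective {m n : ℕ} (h : m ≤ n) : Function.Surjective (cubeRestrict h) := by
  intro y
  refine ⟨fun i => if hi : i.val < m then y ⟨i, hi⟩ else 1, funext fun i => ?_⟩
  simp [cubeRestrict]

lemma sum_comp_cubeRestrict {m n : ℕ} (h : m ≤ n) (g : (Fin m → ℤˣ) → ℝ) :
    ∑ x, g (cubeRestrict h x) = 2 ^ n / 2 ^ m * ∑ y, g y := by
  have hfib : ∀ g : (Fin m → ℤˣ) → ℝ, ∑ x, g (cubeRestrict h x) =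
      (#{x | cubeRestrict h x = 1} : ℝ) * ∑ y, g y := by
    intro g
    rw [← Finset.sum_fiberwise' univ (cubeRestrict h) g, Finset.mul_sum]
    refine Finset.sum_congr rfl fun y _ => ?_
    rw [Finset.sum_const, nsmul_eq_mul, MonoidHom.card_fiber_eq_of_mem_range (cubeRestrict h)
      (cubeRestrict_surjective h y) (cubeRestrict_surjective h 1)]
  have h1 := hfib fun _ => 1
  simp only [Finset.sum_const, Finset.card_univ, Fintype.card_pi, nsmul_eq_mul, mul_one] at h1
  simp only [Fintype.card_units_int, Finset.prod_const, Finset.card_univ, Fintype.card_fin,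
    Nat.cast_pow, Nat.cast_ofNat] at h1
  rw [hfib g, h1, mul_div_cancel_right₀ _ (by positivity)]

lemma walsh_cubeRestrict {m n : ℕ} (h : m ≤ n) (S : Finset (Fin m)) (z : Fin n → ℤˣ) :
    walsh S (cubeRestrict h z) = walsh (S.map (Fin.castLEEmb h)) z := by
  rw [walsh, walsh, Finset.prod_map]
  rfl

lemma SStab_comp_cubeRestrict {m n : ℕ} (h : m ≤ n) (r : ℕ) (f : (Fin m → ℤˣ) → ℝ) :
    SStab n r (fun x => f (cubeRestrict h x)) =
      (∑ S, walshCoef f S ^ 2 * krawt n r S.card) / 4 ^ m := by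
  have h1 : ∑ x : Fin n → ℤˣ, ∑ z ∈ hSphere n r,
      f (cubeRestrict h x) * f (cubeRestrict h (x * z)) =
      2 ^ n / 4 ^ m * ∑ S, walshCoef f S ^ 2 *
        ∑ z ∈ hSphere n r, walsh (S.map (Fin.castLEEmb h)) z := by
    rw [Finset.sum_comm]
    simp_rw [Finset.mul_sum (hSphere n r)]
    rw [Finset.sum_comm (s := univ) (t := hSphere n r), Finset.mul_sum]
    refine Finset.sum_congr rfl fun z _ => ?_
    simp_rw [map_mul, ← walsh_cubeRestrict]
    rw [sum_comp_cubeRestrict h fun y => f y * f (y * cubeRestrict h z), sum_walshCoef_sq_mul,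
      show (4 : ℝ) ^ m = 2 ^ m * 2 ^ m by rw [← mul_pow]; norm_num]
    field_simp
  have h2 : ∀ S : Finset (Fin m), krawt n r S.card =
      (∑ z ∈ hSphere n r, walsh (S.map (Fin.castLEEmb h)) z) / (hSphere n r).card := by
    intro S
    rw [← Finset.card_map (Fin.castLEEmb h), ← sphereMean_eq_krawt, sphereMean]
  simp_rw [SStab, h1, h2, mul_div_assoc']
  rw [← Finset.sum_div, div_mul_eq_mul_div, mul_div_assoc, mul_div_mul_left _ _ (by positivity),
    div_right_comm]

lemma eventually_lt_SStab_comp {r : ℕ → ℕ} {β : ℝ} (hr : ∀ n, r n ≤ n)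
    (hlim : Tendsto (fun n : ℕ => (r n : ℝ) / n) atTop (nhds β)) {m : ℕ}
    (f : (Fin m → ℤˣ) → ℝ) {ε : ℝ} (hε : 0 < ε) :
    ∀ᶠ n in atTop, ∀ h : m ≤ n,
      Stab m β f - ε < SStab n (r n) (fun x => f (cubeRestrict h x)) := by
  have ht := (tendsto_finsetSum (univ : Finset (Finset (Fin m)))
    fun S _ => (tendsto_krawt hr hlim S.card).const_mul (walshCoef f S ^ 2)).div_const (4 ^ m)
  rw [← Stab_eq_sum] at ht
  filter_upwards [ht.eventually_const_lt (sub_lt_self _ hε)] with n hn h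
  rwa [SStab_comp_cubeRestrict]

lemma sum_comp_cubeRestrict_mul_walsh {m n : ℕ} (h : m < n) (g : (Fin m → ℤˣ) → ℝ) :
    ∑ x, g (cubeRestrict h.le x) * walsh univ x = 0 := by
  set u : Fin n → ℤˣ := Pi.mulSingle ⟨m, h⟩ (-1) with hu
  have hres : cubeRestrict h.le u = 1 := by
    funext i
    have hi : Fin.castLE h.le i ≠ ⟨m, h⟩ := fun hi => i.isLt.ne (congrArg Fin.val hi)
    exact Pi.mulSingle_eq_of_ne hi _
  have hw : walsh univ u = -1 := by
    rw [walsh, Finset.prod_eq_single (⟨m, h⟩ : Fin n)]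
    · simp [hu]
    · intro i _ hi
      simp [hu, Pi.mulSingle_eq_of_ne hi]
    · simp
  have hflip := Equiv.sum_comp (Equiv.mulRight u) fun x => g (cubeRestrict h.le x) * walsh univ x
  simp only [Equiv.coe_mulRight, map_mul, hres, mul_one, walsh_mul, hw, mul_neg,
    Finset.sum_neg_distrib] at hflip
  linarith

lemma SStab_even_part {m n r : ℕ} (h : m < n) (hr : Even r) (f : (Fin m → ℤˣ) → ℝ) :
    SStab n r (fun x => f (cubeRestrict h.le x) * ((1 + walsh univ x) / 2)) =
      1 / 2 * SStab n r (fun x => f (cubeRestrict h.le x)) := by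
  have hterm : ∀ x : Fin n → ℤˣ, ∀ z ∈ hSphere n r,
      f (cubeRestrict h.le x) * ((1 + walsh univ x) / 2) *
        (f (cubeRestrict h.le (x * z)) * ((1 + walsh univ (x * z)) / 2)) =
      1 / 2 * (f (cubeRestrict h.le x) * f (cubeRestrict h.le (x * z))) +
      1 / 2 * (f (cubeRestrict h.le x) * f (cubeRestrict h.le x * cubeRestrict h.le z) *
        walsh univ x) := by
    intro x z hz
    rw [walsh_mul, walsh_univ_of_mem_hSphere hr hz, map_mul]
    linear_combination 1 / 4 * (f (cubeRestrict h.le x) *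
      f (cubeRestrict h.le x * cubeRestrict h.le z)) * walsh_mul_self univ x
  have hsum : ∑ x : Fin n → ℤˣ, ∑ z ∈ hSphere n r,
      f (cubeRestrict h.le x) * f (cubeRestrict h.le x * cubeRestrict h.le z) *
        walsh univ x = 0 := by
    rw [Finset.sum_comm]
    exact Finset.sum_eq_zero fun z _ => sum_comp_cubeRestrict_mul_walsh h
      fun y => f y * f (y * cubeRestrict h.le z)
  rw [SStab, Finset.sum_congr rfl fun x _ => Finset.sum_congr rfl (hterm x)]
  simp_rw [Finset.sum_add_distrib]
  simp_rw [← Finset.mul_sum _ _ (1 / 2 : ℝ)]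
  rw [hsum, mul_zero, add_zero, mul_div_assoc]
  rfl

lemma eventually_Stab_sub_le_GammaS {r : ℕ → ℕ} {α β : ℝ} (hr : ∀ n, r n ≤ n)
    (hlim : Tendsto (fun n : ℕ => (r n : ℝ) / n) atTop (nhds β)) (hα0 : 0 < α) (hα1 : α ≤ 1)
    {m : ℕ} {A : Finset (Fin m → ℤˣ)} (hA : A.card = ⌊α * 2 ^ m⌋₊) {ε : ℝ} (hε : 0 < ε) :
    ∀ᶠ n in atTop, Stab m β (indic m A) - ε ≤ GammaS n ⌊α * 2 ^ n⌋₊ (r n) := by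
  filter_upwards [eventually_lt_SStab_comp hr hlim (indic m A) hε, eventually_ge_atTop m]
    with n hn hmn
  set B : Finset (Fin n → ℤˣ) := univ.filter fun x => cubeRestrict hmn x ∈ A with hB
  have hBA : indic n B = fun x => indic m A (cubeRestrict hmn x) := by
    funext x
    simp [indic, hB]
  have hcard : B.card ≤ ⌊α * 2 ^ n⌋₊ := by
    refine Nat.le_floor ?_
    rw [← sum_indic, hBA, sum_comp_cubeRestrict, sum_indic, hA, div_mul_eq_mul_div,
      div_le_iff₀ (by positivity)]
    nlinarith [Nat.floor_le (by positivity : 0 ≤ α * 2 ^ m), pow_pos (two_pos (α := ℝ)) n]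
  have hM : ⌊α * 2 ^ n⌋₊ ≤ 2 ^ n :=
    Nat.floor_le_of_le (by push_cast; exact mul_le_of_le_one_left (by positivity) hα1)
  refine (hn hmn).le.trans ?_
  rw [← hBA]
  exact SStab_indic_le_GammaS hM hcard

lemma eventually_half_Stab_sub_le_GammaS {r : ℕ → ℕ} {α β : ℝ} (hr : ∀ n, r n ≤ n)
    (heven : ∀ n, Even (r n))
    (hlim : Tendsto (fun n : ℕ => (r n : ℝ) / n) atTop (nhds β)) (hα0 : 0 < α) (hα1 : α ≤ 1)
    {m : ℕ} {A : Finset (Fin m → ℤˣ)} (hA : A.card = ⌊2 * α * 2 ^ m⌋₊) {ε : ℝ} (hε : 0 < ε) :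
    ∀ᶠ n in atTop, 1 / 2 * (Stab m β (indic m A) - ε) ≤ GammaS n ⌊α * 2 ^ n⌋₊ (r n) := by
  filter_upwards [eventually_lt_SStab_comp hr hlim (indic m A) hε, eventually_gt_atTop m]
    with n hn hmn
  set B : Finset (Fin n → ℤˣ) :=
    univ.filter fun x => cubeRestrict hmn.le x ∈ A ∧ walsh univ x = 1 with hB
  have hBA : indic n B =
      fun x => indic m A (cubeRestrict hmn.le x) * ((1 + walsh univ x) / 2) := by
    funext x
    rcases eq_or_eq_neg_of_abs_eq (abs_walsh univ x) with h | h
    · simp [indic, hB, h]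
    · simp [indic, hB, h]
      norm_num
  have hcard : B.card ≤ ⌊α * 2 ^ n⌋₊ := by
    refine Nat.le_floor ?_
    have hsplit : (B.card : ℝ) = 1 / 2 * ∑ x, indic m A (cubeRestrict hmn.le x) +
        1 / 2 * ∑ x, indic m A (cubeRestrict hmn.le x) * walsh univ x := by
      rw [← sum_indic, hBA, Finset.mul_sum, Finset.mul_sum, ← Finset.sum_add_distrib]
      exact Finset.sum_congr rfl fun x _ => by ring
    rw [hsplit, sum_comp_cubeRestrict_mul_walsh hmn, mul_zero, add_zero, sum_comp_cubeRestrict,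
      sum_indic, hA, ← mul_assoc, mul_div_assoc', div_mul_eq_mul_div, div_le_iff₀ (by positivity)]
    nlinarith [Nat.floor_le (by positivity : 0 ≤ 2 * α * 2 ^ m), pow_pos (two_pos (α := ℝ)) n]
  have hM : ⌊α * 2 ^ n⌋₊ ≤ 2 ^ n :=
    Nat.floor_le_of_le (by push_cast; exact mul_le_of_le_one_left (by positivity) hα1)
  calc 1 / 2 * (Stab m β (indic m A) - ε)
      ≤ 1 / 2 * SStab n (r n) (fun x => indic m A (cubeRestrict hmn.le x)) := by
        linarith [hn hmn.le]
    _ = SStab n (r n) (indic n B) := by rw [hBA, SStab_even_part hmn (heven n)]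
    _ ≤ _ := SStab_indic_le_GammaS hM hcard

lemma two_mul_floor_half_le {β : ℝ} (hβ0 : 0 < β) (n : ℕ) :
    ((2 * ⌊β * n / 2⌋₊ : ℕ) : ℝ) ≤ β * n := by
  push_cast
  linarith [Nat.floor_le (by positivity : 0 ≤ β * n / 2)]

lemma tendsto_two_mul_floor_half_div {β : ℝ} (hβ0 : 0 < β) :
    Tendsto (fun n : ℕ => ((2 * ⌊β * n / 2⌋₊ : ℕ) : ℝ) / n) atTop (nhds β) := by
  have hlow : Tendsto (fun n : ℕ => β - 2 / (n : ℝ)) atTop (nhds β) := by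
    simpa using (tendsto_const_nhds (x := β)).sub (tendsto_const_div_atTop_nhds_zero_nat 2)
  refine tendsto_of_tendsto_of_tendsto_of_le_of_le' hlow tendsto_const_nhds ?_ ?_
  · filter_upwards [eventually_gt_atTop 0] with n hn
    have hn' : (0 : ℝ) < n := by exact_mod_cast hn
    rw [le_div_iff₀ hn', sub_mul, div_mul_cancel₀ _ hn'.ne']
    push_cast
    linarith [Nat.lt_floor_add_one (β * n / 2)]
  · filter_upwards [eventually_gt_atTop 0] with n hn
    have hn' : (0 : ℝ) < n := by exact_mod_cast hn
    rw [div_le_iff₀ hn']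
    exact two_mul_floor_half_le hβ0 n

/-- from Theorem 5: bounds on `liminf`/`limsup` of
`a_n := Γ_S^(n)(⌊α·2^n⌋, 2⌊βn/2⌋)` for `0 < α, β ≤ 1/2`. -/
theorem gammaS_even_bounds (α β : ℝ) (hα1 : 0 < α) (hα2 : α ≤ 1 / 2)
    (hβ1 : 0 < β) (hβ2 : β ≤ 1 / 2) :
    GammaIIDlim α β ≤
        liminf (fun n : ℕ => GammaS n ⌊α * 2 ^ n⌋₊ (2 * ⌊β * n / 2⌋₊)) atTop ∧
    (1 / 2) * GammaIIDlim (2 * α) β ≤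
        liminf (fun n : ℕ => GammaS n ⌊α * 2 ^ n⌋₊ (2 * ⌊β * n / 2⌋₊)) atTop ∧
    limsup (fun n : ℕ => GammaS n ⌊α * 2 ^ n⌋₊ (2 * ⌊β * n / 2⌋₊)) atTop ≤
        2 * GammaIIDlim α β := by
  set r : ℕ → ℕ := fun n => 2 * ⌊β * n / 2⌋₊
  set a : ℕ → ℝ := fun n => GammaS n ⌊α * 2 ^ n⌋₊ (2 * ⌊β * n / 2⌋₊)
  have hr : ∀ n, r n ≤ n := fun n => by
    have h := two_mul_floor_half_le hβ1 n
    have h' : β * n ≤ n := mul_le_of_le_one_left (Nat.cast_nonneg n) (by linarith)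
    exact_mod_cast h.trans h'
  have heven : ∀ n, Even (r n) := fun n => even_two_mul _
  have hlim : Tendsto (fun n : ℕ => (r n : ℝ) / n) atTop (nhds β) :=
    tendsto_two_mul_floor_half_div hβ1
  have hbdd : IsBoundedUnder (· ≤ ·) atTop a :=
    isBoundedUnder_of ⟨1, fun n => GammaS_le_one _ _ _⟩
  have hbdd' : IsBoundedUnder (· ≥ ·) atTop a :=
    isBoundedUnder_of ⟨0, fun n => GammaS_nonneg _ _ _⟩
  have hliminf0 : 0 ≤ liminf a atTop :=
    le_liminf_of_le hbdd.isCoboundedUnder_ge (Eventually.of_forall fun n => GammaS_nonneg _ _ _)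
  refine ⟨GammaIIDlim_le hliminf0 fun m A hA => ?_, ?_, ?_⟩
  · refine le_of_forall_pos_le_add fun ε hε => sub_le_iff_le_add.1 ?_
    exact le_liminf_of_le hbdd.isCoboundedUnder_ge
      (eventually_Stab_sub_le_GammaS hr hlim hα1 (by linarith) hA hε)
  · suffices h : GammaIIDlim (2 * α) β ≤ 2 * liminf a atTop by linarith
    refine GammaIIDlim_le (by linarith) fun m A hA => ?_
    refine le_of_forall_pos_le_add fun ε hε => ?_
    have h := le_liminf_of_le hbdd.isCoboundedUnder_ge
      (eventually_half_Stab_sub_le_GammaS hr heven hlim hα1 (by linarith) hA hε)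
    linarith
  · refine le_of_forall_pos_le_add fun ε hε => ?_
    refine limsup_le_of_le hbdd'.isCoboundedUnder_le ?_
    filter_upwards [eventually_SStab_le hr heven hlim hβ1 hβ2 hε] with n hn
    refine Real.sSup_le ?_ (by linarith [GammaIIDlim_nonneg (α := α) hβ2])
    rintro _ ⟨A, hA, rfl⟩
    linarith [hn A, Stab_indic_le_GammaIIDlim hβ1 hβ2 hA]
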